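/- arXiv:2307.05224 — 6 statements merged into one kernel-verified Lean document; each statement's English description precedes it below -/
import Mathlib

section
/- Let N ≥ 1, ρ > 0, η > 0, and let Q denote the standard Gaussian tail function Q(x) = 1 − Φ(x), where Φ is the cumulative distribution function of the standard normal distribution. For every feasible weight vector w (∑_j w_j = 1, w_j ≥ 0), one has Q(√(2η/(1+ρ²)) · ρ / √(∑_j w_j²)) ≥ Q(√(2ηN/(1+ρ²)) · ρ), with equality if and only if w_j = 1/N for all j. That is, the equal-weight vector uniquely minimizes the false-alarm probability among feasible weight vectors. -/
open Finset

/-- The standard Gaussian tail function `Q(x) = 1 - Φ(x)`, where `Φ` is the CDF of the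
standard normal distribution. -/
noncomputable def gaussQ (x : ℝ) : ℝ :=
  1 - ProbabilityTheory.cdf (ProbabilityTheory.gaussianReal 0 1) x

open MeasureTheory ProbabilityTheory in
theorem strictMono_cdf_of_volume_absolutelyContinuous (μ : Measure ℝ) [IsProbabilityMeasure μ]
    (hμ : volume ≪ μ) : StrictMono (cdf μ) := by
  intro a b hab
  by_contra! hle
  have hzero : μ (Set.Ioc a b) = 0 := by
    rw [← measure_cdf μ, StieltjesFunction.measure_Ioc, ENNReal.ofReal_eq_zero]
    linarith
  have hvol := hμ hzero
  rw [Real.volume_Ioc, ENNReal.ofReal_eq_zero] at hvol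
  linarith

theorem strictAnti_gaussQ : StrictAnti gaussQ := fun _ _ hab =>
  sub_lt_sub_left (strictMono_cdf_of_volume_absolutelyContinuous _
    (ProbabilityTheory.gaussianReal_absolutelyContinuous' 0 one_ne_zero) hab) 1

theorem sum_sq_sub_inv_card {N : ℕ} (hN : 1 ≤ N) (w : Fin N → ℝ) (hsum : ∑ j, w j = 1) :
    ∑ j, (w j - 1 / N) ^ 2 = ∑ j, w j ^ 2 - 1 / N := by
  have hN0 : (N : ℝ) ≠ 0 := by positivity
  simp only [sub_sq, sum_add_distrib, sum_sub_distrib, ← sum_mul, ← mul_sum, hsum, sum_const,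
    card_univ, Fintype.card_fin, nsmul_eq_mul]
  field_simp
  ring

theorem inv_card_le_sum_sq {N : ℕ} (hN : 1 ≤ N) (w : Fin N → ℝ) (hsum : ∑ j, w j = 1) :
    1 / (N : ℝ) ≤ ∑ j, w j ^ 2 := by
  rw [← sub_nonneg, ← sum_sq_sub_inv_card hN w hsum]
  positivity

theorem sum_sq_eq_inv_card_iff {N : ℕ} (hN : 1 ≤ N) (w : Fin N → ℝ) (hsum : ∑ j, w j = 1) :
    ∑ j, w j ^ 2 = 1 / N ↔ ∀ j, w j = 1 / N := by
  rw [← sub_eq_zero, ← sum_sq_sub_inv_card hN w hsum,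
    sum_eq_zero_iff_of_nonneg fun _ _ => sq_nonneg _]
  simp [sub_eq_zero]

theorem equal_weights_minimize_false_alarm
    (N : ℕ) (hN : 1 ≤ N) (ρ η : ℝ) (hρ : 0 < ρ) (hη : 0 < η)
    (w : Fin N → ℝ) (hsum : ∑ j, w j = 1) (hpos : ∀ j, 0 ≤ w j) :
    gaussQ (Real.sqrt (2 * η * N / (1 + ρ ^ 2)) * ρ) ≤
      gaussQ (Real.sqrt (2 * η / (1 + ρ ^ 2)) * ρ / Real.sqrt (∑ j, (w j) ^ 2)) ∧
    (gaussQ (Real.sqrt (2 * η / (1 + ρ ^ 2)) * ρ / Real.sqrt (∑ j, (w j) ^ 2)) =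
        gaussQ (Real.sqrt (2 * η * N / (1 + ρ ^ 2)) * ρ) ↔ ∀ j, w j = 1 / N) := by
  have hN0 : (0 : ℝ) < 1 / N := by positivity
  have hle := inv_card_le_sum_sq hN w hsum
  have hc : 0 < Real.sqrt (2 * η / (1 + ρ ^ 2)) * ρ := by positivity
  have hequal : Real.sqrt (2 * η * N / (1 + ρ ^ 2)) * ρ =
      Real.sqrt (2 * η / (1 + ρ ^ 2)) * ρ / Real.sqrt (1 / N) := by
    rw [mul_div_right_comm (2 * η), Real.sqrt_mul (by positivity), one_div, Real.sqrt_inv,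
      div_inv_eq_mul, mul_right_comm]
  rw [hequal, strictAnti_gaussQ.le_iff_ge, strictAnti_gaussQ.injective.eq_iff]
  constructor
  · have := Real.sqrt_pos.2 hN0
    gcongr
  · rw [div_eq_mul_inv _ √(∑ j, w j ^ 2), div_eq_mul_inv _ √(1 / (N : ℝ)),
      mul_right_inj' hc.ne', inv_inj, Real.sqrt_inj (hN0.le.trans hle) hN0.le]
    exact sum_sq_eq_inv_card_iff hN w hsum
end

section
/- Let N ≥ 1, ρ ∈ (0,1), and γ : Fin N → ℝ with γ_j > ρ/(1−ρ) for all j. Define A_j = (1−ρ)·γ_j − ρ, B_j = (1−ρ)²·γ_j + (1+ρ²)/2, and w^o_j = c·A_j/B_j with c = (∑_m A_m/B_m)^{−1}. Then w^o satisfies the stationarity equation for every j ∈ {1,…,N}: A_j · ∑_{m ≠ j} (w^o_m)²·B_m = w^o_j·B_j · ∑_{m ≠ j} w^o_m·A_m. -/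
open Finset

theorem optimal_md_weights_stationary
    (N : ℕ) (hN : 1 ≤ N) (ρ : ℝ) (hρ : 0 < ρ) (hρ1 : ρ < 1)
    (γ : Fin N → ℝ) (hγ : ∀ j, ρ / (1 - ρ) < γ j)
    (A B wo : Fin N → ℝ) (c : ℝ)
    (hA : ∀ j, A j = (1 - ρ) * γ j - ρ)
    (hB : ∀ j, B j = (1 - ρ) ^ 2 * γ j + (1 + ρ ^ 2) / 2)
    (hc : c = (∑ m, A m / B m)⁻¹)
    (hwo : ∀ j, wo j = c * (A j / B j)) :
    ∀ j, A j * ∑ m ∈ Finset.univ.erase j, (wo m) ^ 2 * B m =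
      wo j * B j * ∑ m ∈ Finset.univ.erase j, wo m * A m := by
  have hB0 : ∀ j, B j ≠ 0 := fun j => by
    have hγ0 : 0 < γ j := (div_pos hρ (sub_pos.2 hρ1)).trans (hγ j)
    rw [hB]
    positivity
  have hwB : ∀ j, wo j * B j = c * A j := fun j => by
    rw [hwo, mul_assoc, div_mul_cancel₀ _ (hB0 j)]
  intro j
  rw [hwB, Finset.mul_sum, Finset.mul_sum]
  refine Finset.sum_congr rfl fun m _ => ?_
  rw [sq, mul_assoc (wo m), hwB]
  ring
end

section
/- Let N ≥ 1, ρ ∈ (0,1), and γ : Fin N → ℝ with γ_j > ρ/(1−ρ) for all j. Define A_j = (1−ρ)·γ_j − ρ, B_j = (1−ρ)²·γ_j + (1+ρ²)/2, g(w) = (∑_j w_j·A_j)² / (∑_j w_j²·B_j), and w^o_j = c·A_j/B_j with c = (∑_m A_m/B_m)^{−1}. Then for every feasible weight vector w (∑_j w_j = 1, w_j ≥ 0) with w ≠ w^o, one has g(w) < g(w^o). That is, w^o is the unique global maximizer of g over the set of feasible weight vectors. -/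
open Finset

/-- Expansion of the weighted squared distance from `w` to a multiple of `A / B`. -/
theorem sum_mul_sub_div_sq {ι : Type*} [Fintype ι] {A B : ι → ℝ} (hB : ∀ j, 0 < B j)
    (w : ι → ℝ) (t : ℝ) :
    ∑ j, B j * (w j - t * (A j / B j)) ^ 2 =
      ∑ j, w j ^ 2 * B j - 2 * t * ∑ j, w j * A j + t ^ 2 * ∑ j, A j ^ 2 / B j := by
  rw [mul_sum, mul_sum, ← sum_sub_distrib, ← sum_add_distrib]
  refine sum_congr rfl fun j _ => ?_
  have := (hB j).ne'
  field_simp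
  ring

/-- Strict weighted Cauchy–Schwarz inequality: equality is excluded when `w` is not a multiple
of `A / B`. -/
theorem sq_sum_mul_lt_of_not_proportional {ι : Type*} [Fintype ι] {A B w : ι → ℝ}
    (hB : ∀ j, 0 < B j) (hT : 0 < ∑ j, A j ^ 2 / B j)
    (hw : ∀ t : ℝ, ∃ j, w j ≠ t * (A j / B j)) :
    (∑ j, w j * A j) ^ 2 < (∑ j, A j ^ 2 / B j) * ∑ j, w j ^ 2 * B j := by
  set P := ∑ j, w j * A j
  set T := ∑ j, A j ^ 2 / B j
  obtain ⟨j, hj⟩ := hw (P / T)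
  have hpos : 0 < ∑ j, B j * (w j - P / T * (A j / B j)) ^ 2 :=
    sum_pos' (fun i _ => mul_nonneg (hB i).le (sq_nonneg _))
      ⟨j, mem_univ j, mul_pos (hB j) (sq_pos_of_ne_zero (sub_ne_zero.mpr hj))⟩
  rw [sum_mul_sub_div_sq hB] at hpos
  have hexp : T * (∑ j, w j ^ 2 * B j - 2 * (P / T) * P + (P / T) ^ 2 * T) =
      T * ∑ j, w j ^ 2 * B j - P ^ 2 := by
    field_simp
    ring
  have := mul_pos hT hpos
  linarith

theorem optimal_md_weights_unique_global_max
    (N : ℕ) (hN : 1 ≤ N) (ρ : ℝ) (hρ : 0 < ρ) (hρ1 : ρ < 1)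
    (γ : Fin N → ℝ) (hγ : ∀ j, ρ / (1 - ρ) < γ j)
    (A B wo : Fin N → ℝ) (c : ℝ) (g : (Fin N → ℝ) → ℝ)
    (hA : ∀ j, A j = (1 - ρ) * γ j - ρ)
    (hB : ∀ j, B j = (1 - ρ) ^ 2 * γ j + (1 + ρ ^ 2) / 2)
    (hg : ∀ v : Fin N → ℝ, g v = (∑ j, v j * A j) ^ 2 / (∑ j, (v j) ^ 2 * B j))
    (hc : c = (∑ m, A m / B m)⁻¹)
    (hwo : ∀ j, wo j = c * (A j / B j))
    (w : Fin N → ℝ) (hsum : ∑ j, w j = 1) (hpos : ∀ j, 0 ≤ w j)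
    (hne : w ≠ wo) :
    g w < g wo := by
  have hρ' : 0 < 1 - ρ := sub_pos.mpr hρ1
  have hApos : ∀ j, 0 < A j := fun j => by
    have := (div_lt_iff₀ hρ').mp (hγ j)
    rw [hA]
    linarith
  have hBpos : ∀ j, 0 < B j := fun j => by
    have : 0 < γ j := (div_pos hρ hρ').trans (hγ j)
    rw [hB]
    positivity
  have : Nonempty (Fin N) := ⟨⟨0, hN⟩⟩
  have hS : 0 < ∑ j, A j / B j :=
    sum_pos (fun j _ => div_pos (hApos j) (hBpos j)) univ_nonempty
  have hT : 0 < ∑ j, A j ^ 2 / B j :=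
    sum_pos (fun j _ => div_pos (pow_pos (hApos j) 2) (hBpos j)) univ_nonempty
  have hc0 : c ≠ 0 := hc ▸ (inv_pos.mpr hS).ne'
  have hnum : ∑ j, wo j * A j = c * ∑ j, A j ^ 2 / B j := by
    rw [mul_sum]
    refine sum_congr rfl fun j _ => ?_
    rw [hwo]
    ring
  have hden : ∑ j, wo j ^ 2 * B j = c ^ 2 * ∑ j, A j ^ 2 / B j := by
    rw [mul_sum]
    refine sum_congr rfl fun j _ => ?_
    have := (hBpos j).ne'
    rw [hwo]
    field_simp
  have hgwo : g wo = ∑ j, A j ^ 2 / B j := by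
    rw [hg, hnum, hden]
    field_simp
  have hD : 0 < ∑ j, w j ^ 2 * B j := by
    obtain ⟨j, -, hj⟩ := exists_ne_zero_of_sum_ne_zero (hsum ▸ one_ne_zero : ∑ j, w j ≠ 0)
    exact sum_pos' (fun i _ => mul_nonneg (sq_nonneg _) (hBpos i).le)
      ⟨j, mem_univ j, mul_pos (sq_pos_of_ne_zero hj) (hBpos j)⟩
  rw [hgwo, hg, div_lt_iff₀ hD]
  refine sq_sum_mul_lt_of_not_proportional hBpos hT fun t => ?_
  by_contra! h
  have ht : t = c := by
    rw [hc]
    refine eq_inv_of_mul_eq_one_left ?_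
    rw [mul_sum, ← hsum]
    exact sum_congr rfl fun j _ => (h j).symm
  exact hne (funext fun j => by rw [h, hwo, ht])
end

section
/- Let N ≥ 2, ρ ∈ (0,1), and γ : Fin N → ℝ with γ_j > ρ/(1−ρ) for all j. Define A_j = (1−ρ)·γ_j − ρ, B_j = (1−ρ)²·γ_j + (1+ρ²)/2, w^o_j = c·A_j/B_j with c = (∑_m A_m/B_m)^{−1}, and g(w) = (∑_j w_j·A_j)²/(∑_j w_j²·B_j). Let w be a feasible weight vector with w ≠ w^o, and let i be an index attaining the minimum of the weight ratios w_j/w^o_j over j. Then the partial derivative of g at w in coordinate i is strictly positive: ∂g(w)/∂w_i > 0. -/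
open Finset

/-- The partial derivative of `v ↦ (∑ j, v j * A j) ^ 2 / ∑ j, v j ^ 2 * B j` in coordinate `i`. -/
theorem hasDerivAt_update_sq_sum_div_sum_sq {ι : Type*} [Fintype ι] [DecidableEq ι]
    (A B w : ι → ℝ) (i : ι) (hD : ∑ j, w j ^ 2 * B j ≠ 0) :
    HasDerivAt (fun t : ℝ => (∑ j, Function.update w i t j * A j) ^ 2 /
        ∑ j, Function.update w i t j ^ 2 * B j)
      (2 * (∑ j, w j * A j) *
        (A i * ∑ j, w j ^ 2 * B j - w i * B i * ∑ j, w j * A j) /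
          (∑ j, w j ^ 2 * B j) ^ 2) (w i) := by
  have hu : ∀ j, HasDerivAt (fun t : ℝ => Function.update w i t j)
      ((Pi.single i 1 : ι → ℝ) j) (w i) :=
    hasDerivAt_pi.1 (hasDerivAt_update w i (w i))
  have hS : HasDerivAt (fun t : ℝ => ∑ j, Function.update w i t j * A j) (A i) (w i) := by
    refine (HasDerivAt.fun_sum fun j _ => (hu j).mul_const (A j)).congr_deriv ?_
    simp [Pi.single_apply]
  have hQ : HasDerivAt (fun t : ℝ => ∑ j, Function.update w i t j ^ 2 * B j)
      (2 * w i * B i) (w i) := by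
    refine (HasDerivAt.fun_sum fun j _ => ((hu j).fun_pow 2).mul_const (B j)).congr_deriv ?_
    simp [Pi.single_apply]
  refine ((hS.fun_pow 2).fun_div hQ (by simpa using hD)).congr_deriv ?_
  simp only [Function.update_eq_self]
  ring

/-- If `i` minimises `w j * B j / A j` and the minimum is not attained at every index, then
`w i * B i * ∑ j, w j * A j < A i * ∑ j, w j ^ 2 * B j`. -/
theorem mul_sum_lt_mul_sum_sq_of_min_ratio {ι : Type*} [Fintype ι] {A B w : ι → ℝ} {i : ι}
    (hA : ∀ j, 0 < A j) (hB : ∀ j, 0 < B j) (hw : ∀ j, 0 ≤ w j)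
    (hmin : ∀ j, w i * B i * A j ≤ A i * (w j * B j))
    (hlt : ∃ j, w i * B i * A j < A i * (w j * B j)) :
    w i * B i * ∑ j, w j * A j < A i * ∑ j, w j ^ 2 * B j := by
  rw [mul_sum, mul_sum]
  refine sum_lt_sum (fun j _ => ?_) ?_
  · have := hw j
    linear_combination w j * hmin j
  · obtain ⟨j, hj⟩ := hlt
    have hwj : 0 < w j := by
      refine (hw j).lt_of_ne fun h => hj.not_ge ?_
      rw [← h, zero_mul, mul_zero]
      exact mul_nonneg (mul_nonneg (hw i) (hB i).le) (hA j).le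
    refine ⟨j, mem_univ j, ?_⟩
    linear_combination w j * hj

theorem deriv_pos_at_min_ratio_index
    (N : ℕ) (hN : 2 ≤ N) (ρ : ℝ) (hρ : 0 < ρ) (hρ1 : ρ < 1)
    (γ : Fin N → ℝ) (hγ : ∀ j, ρ / (1 - ρ) < γ j)
    (A B wo : Fin N → ℝ) (c : ℝ) (g : (Fin N → ℝ) → ℝ)
    (hA : ∀ j, A j = (1 - ρ) * γ j - ρ)
    (hB : ∀ j, B j = (1 - ρ) ^ 2 * γ j + (1 + ρ ^ 2) / 2)
    (hc : c = (∑ m, A m / B m)⁻¹)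
    (hwo : ∀ j, wo j = c * (A j / B j))
    (hg : ∀ v : Fin N → ℝ, g v = (∑ j, v j * A j) ^ 2 / (∑ j, (v j) ^ 2 * B j))
    (w : Fin N → ℝ) (hsum : ∑ j, w j = 1) (hpos : ∀ j, 0 ≤ w j)
    (hne : w ≠ wo)
    (i : Fin N) (hi : ∀ j, w i / wo i ≤ w j / wo j) :
    0 < deriv (fun t : ℝ => g (Function.update w i t)) (w i) := by
  have hρ' : 0 < 1 - ρ := sub_pos.2 hρ1
  have hApos : ∀ j, 0 < A j := fun j => by
    have := (div_lt_iff₀ hρ').1 (hγ j)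
    rw [hA]
    linarith
  have hBpos : ∀ j, 0 < B j := fun j => by
    have : 0 < γ j := (div_pos hρ hρ').trans (hγ j)
    rw [hB]
    positivity
  have hT : 0 < ∑ m, A m / B m :=
    sum_pos (fun m _ => div_pos (hApos m) (hBpos m)) ⟨i, mem_univ i⟩
  have hcpos : 0 < c := hc ▸ inv_pos.2 hT
  have hmin : ∀ j, w i * B i * A j ≤ A i * (w j * B j) := fun j => by
    have h := hi j
    have hAi := hApos i
    have hAj := hApos j
    have hBi := hBpos i
    have hBj := hBpos j
    rw [hwo, hwo, div_le_div_iff₀ (by positivity) (by positivity)] at h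
    have h' := mul_le_mul_of_nonneg_right h (by positivity : 0 ≤ B i * B j / c)
    field_simp at h'
    linarith
  have hlt : ∃ j, w i * B i * A j < A i * (w j * B j) := by
    by_contra! hle
    have hw : ∀ j, w j = w i * B i / A i * (A j / B j) := fun j => by
      have h := (hmin j).antisymm (hle j)
      have hAi := (hApos i).ne'
      have hBj := (hBpos j).ne'
      field_simp
      linarith
    refine hne (funext fun j => ?_)
    have hk : w i * B i / A i * ∑ m, A m / B m = 1 := by
      rw [mul_sum, ← hsum]
      exact sum_congr rfl fun j _ => (hw j).symm
    rw [hwo, hc, ← eq_inv_of_mul_eq_one_left hk]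
    exact hw j
  obtain ⟨k, -, hk⟩ : ∃ k ∈ univ, 0 < w k := by
    refine exists_lt_of_sum_lt (s := univ) (f := fun _ => (0 : ℝ)) ?_
    simp [hsum]
  have hS : 0 < ∑ j, w j * A j :=
    sum_pos' (fun j _ => mul_nonneg (hpos j) (hApos j).le)
      ⟨k, mem_univ k, mul_pos hk (hApos k)⟩
  have hD : 0 < ∑ j, w j ^ 2 * B j :=
    sum_pos' (fun j _ => mul_nonneg (sq_nonneg _) (hBpos j).le)
      ⟨k, mem_univ k, mul_pos (pow_pos hk 2) (hBpos k)⟩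
  have hgap := sub_pos.2 (mul_sum_lt_mul_sum_sq_of_min_ratio hApos hBpos hpos hmin hlt)
  simp only [hg]
  rw [(hasDerivAt_update_sq_sum_div_sum_sq A B w i hD.ne').deriv]
  positivity
end

section
/- Let N ≥ 2, ρ ∈ (0,1), and γ : Fin N → ℝ with γ_j > ρ/(1−ρ) for all j. Define A_j = (1−ρ)·γ_j − ρ, B_j = (1−ρ)²·γ_j + (1+ρ²)/2, w^o_j = c·A_j/B_j with c = (∑_m A_m/B_m)^{−1}, and g(w) = (∑_j w_j·A_j)²/(∑_j w_j²·B_j). Let w be a feasible weight vector with w ≠ w^o, let K = {k : w_k/w^o_k = max_j w_j/w^o_j} and I = {i : w_i/w^o_i = min_j w_j/w^o_j}. Then there exists ε₀ > 0 such that for all ε ∈ (0, ε₀), the vector w' defined by w'_k = w_k − ε/|K| for k ∈ K, w'_i = w_i + ε/|I| for i ∈ I, and w'_j = w_j otherwise, is feasible and satisfies g(w') > g(w). -/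
open Finset

/-- A weighted sum of squares with positive weights is positive at a vector summing to one. -/
lemma sum_sq_mul_pos_of_sum_eq_one {ι : Type*} [Fintype ι] {v B : ι → ℝ} (hB : ∀ j, 0 < B j)
    (hv : ∑ j, v j = 1) : 0 < ∑ j, v j ^ 2 * B j := by
  obtain ⟨j, -, hj⟩ : ∃ j ∈ univ, v j ≠ 0 := exists_ne_zero_of_sum_ne_zero (by simp [hv])
  exact sum_pos' (fun i _ => mul_nonneg (sq_nonneg _) (hB i).le)
    ⟨j, mem_univ j, mul_pos (by positivity) (hB j)⟩

/-- A quotient of a squared linear form by a quadratic one increases along a direction with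
positive derivative, with an explicit bound on the step. -/
lemma sq_div_lt_sq_div_of_step {S Q a b q ε : ℝ} (hQ : 0 < Q) (hε : 0 < ε)
    (hQ' : 0 < Q + 2 * ε * b + ε ^ 2 * q)
    (hstep : ε * (S ^ 2 * q) < 2 * S * (a * Q - S * b)) :
    S ^ 2 / Q < (S + ε * a) ^ 2 / (Q + 2 * ε * b + ε ^ 2 * q) := by
  rw [div_lt_div_iff₀ hQ hQ']
  nlinarith [mul_pos hε (sub_pos.2 hstep), mul_nonneg (sq_nonneg (ε * a)) hQ.le]

/-- The direction moving unit mass uniformly from `K` to `I`. -/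
noncomputable def transferDirection {ι : Type*} [DecidableEq ι] (K I : Finset ι) (j : ι) : ℝ :=
  (if j ∈ I then 1 / (I.card : ℝ) else 0) - (if j ∈ K then 1 / (K.card : ℝ) else 0)

lemma sum_transferDirection_mul {ι : Type*} [Fintype ι] [DecidableEq ι] (K I : Finset ι)
    (f : ι → ℝ) :
    ∑ j, transferDirection K I j * f j
      = 1 / (I.card : ℝ) * ∑ j ∈ I, f j - 1 / (K.card : ℝ) * ∑ j ∈ K, f j := by
  simp [transferDirection, sub_mul, ite_mul, sum_sub_distrib, mul_sum]

lemma sum_transferDirection {ι : Type*} [Fintype ι] [DecidableEq ι] {K I : Finset ι}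
    (hK : K.Nonempty) (hI : I.Nonempty) : ∑ j, transferDirection K I j = 0 := by
  have h := sum_transferDirection_mul K I (fun _ => 1)
  have hK' : (K.card : ℝ) ≠ 0 := by simpa using hK.ne_empty
  have hI' : (I.card : ℝ) ≠ 0 := by simpa using hI.ne_empty
  simpa [hK', hI'] using h

/-- The derivative of the objective in coordinate `j`, up to a positive factor, when
`w m = r m * (c * (A m / B m))`. -/
lemma gradient_coord_eq_sum_ratio_sub {ι : Type*} [Fintype ι] {w r A B : ι → ℝ} {c : ℝ}
    (h : ∀ m, w m * B m = c * r m * A m) (j : ι) :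
    A j * (∑ m, w m ^ 2 * B m) - (∑ m, w m * A m) * (w j * B j)
      = c * A j * ∑ m, w m * A m * (r m - r j) := by
  rw [h j, mul_sum, sum_mul, mul_sum, ← sum_sub_distrib]
  refine sum_congr rfl fun m _ => ?_
  linear_combination A j * w m * h m

theorem perturbation_improves_objective
    (N : ℕ) (hN : 2 ≤ N) (ρ : ℝ) (hρ : 0 < ρ) (hρ1 : ρ < 1)
    (γ : Fin N → ℝ) (hγ : ∀ j, ρ / (1 - ρ) < γ j)
    (A B wo : Fin N → ℝ) (c : ℝ) (g : (Fin N → ℝ) → ℝ)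
    (hA : ∀ j, A j = (1 - ρ) * γ j - ρ)
    (hB : ∀ j, B j = (1 - ρ) ^ 2 * γ j + (1 + ρ ^ 2) / 2)
    (hc : c = (∑ m, A m / B m)⁻¹)
    (hwo : ∀ j, wo j = c * (A j / B j))
    (hg : ∀ v : Fin N → ℝ, g v = (∑ j, v j * A j) ^ 2 / (∑ j, (v j) ^ 2 * B j))
    (w : Fin N → ℝ) (hsum : ∑ j, w j = 1) (hpos : ∀ j, 0 ≤ w j)
    (hne : w ≠ wo)
    (K I : Finset (Fin N))
    (hK : K = Finset.univ.filter (fun k => ∀ j, w j / wo j ≤ w k / wo k))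
    (hI : I = Finset.univ.filter (fun i => ∀ j, w i / wo i ≤ w j / wo j)) :
    ∃ ε₀ > 0, ∀ ε : ℝ, 0 < ε → ε < ε₀ →
      ∀ w' : Fin N → ℝ,
        (w' = fun j =>
          if j ∈ K then w j - ε / K.card
          else if j ∈ I then w j + ε / I.card
          else w j) →
        (∑ j, w' j = 1) ∧ (∀ j, 0 ≤ w' j) ∧ g w < g w' := by
  have hρ' : 0 < 1 - ρ := by linarith
  have hγ0 : ∀ j, 0 < γ j := fun j => (div_pos hρ hρ').trans (hγ j)
  have hA0 : ∀ j, 0 < A j := fun j => by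
    have := (div_lt_iff₀ hρ').1 (hγ j)
    rw [hA]; linarith
  have hB0 : ∀ j, 0 < B j := fun j => by
    have := hγ0 j
    rw [hB]; positivity
  have : Nonempty (Fin N) := ⟨⟨0, by omega⟩⟩
  have hT : 0 < ∑ m, A m / B m :=
    sum_pos (fun m _ => div_pos (hA0 m) (hB0 m)) univ_nonempty
  have hc0 : 0 < c := hc ▸ inv_pos.2 hT
  have hwo0 : ∀ j, 0 < wo j := fun j => hwo j ▸ mul_pos hc0 (div_pos (hA0 j) (hB0 j))
  have hwo_sum : ∑ j, wo j = 1 := by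
    simp_rw [hwo]
    rw [← mul_sum, hc, inv_mul_cancel₀ hT.ne']
  obtain ⟨r, hr⟩ : ∃ r : Fin N → ℝ, ∀ j, r j = w j / wo j := ⟨_, fun _ => rfl⟩
  simp only [← hr] at hK hI
  have hw : ∀ j, w j = r j * wo j := fun j => by rw [hr, div_mul_cancel₀ _ (hwo0 j).ne']
  have hr0 : ∀ j, 0 ≤ r j := fun j => hr j ▸ div_nonneg (hpos j) (hwo0 j).le
  have hwB : ∀ m, w m * B m = c * r m * A m := fun m => by
    rw [hw, hwo]
    field_simp [(hB0 m).ne']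
  have hKmax : ∀ k ∈ K, ∀ j, r j ≤ r k := fun k hk => by simpa [hK] using hk
  have hImin : ∀ i ∈ I, ∀ j, r i ≤ r j := fun i hi => by simpa [hI] using hi
  obtain ⟨k₀, hk₀⟩ := Finite.exists_max r
  obtain ⟨i₀, hi₀⟩ := Finite.exists_min r
  have hk₀K : k₀ ∈ K := by simpa [hK] using hk₀
  have hi₀I : i₀ ∈ I := by simpa [hI] using hi₀
  have hlt₀ : r i₀ < r k₀ := by
    by_contra! hle
    have hconst : ∀ j, r j = r k₀ := fun j => le_antisymm (hk₀ j) (hle.trans (hi₀ j))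
    have hone : r k₀ = 1 := by
      have : ∑ j, w j = r k₀ * ∑ j, wo j := by
        rw [mul_sum]
        exact sum_congr rfl fun j _ => by rw [hw j, hconst j]
      rw [hsum, hwo_sum] at this
      linarith
    exact hne (funext fun j => by rw [hw j, hconst j, hone, one_mul])
  have hlt : ∀ i ∈ I, ∀ k ∈ K, r i < r k := fun i hi k hk =>
    (hImin i hi i₀).trans_lt (hlt₀.trans_le (hKmax k hk k₀))
  have hwK : ∀ k ∈ K, 0 < w k := fun k hk => by
    rw [hw k]
    exact mul_pos ((hr0 i₀).trans_lt (hlt i₀ hi₀I k hk)) (hwo0 k)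
  have hKne : K.Nonempty := ⟨k₀, hk₀K⟩
  have hIne : I.Nonempty := ⟨i₀, hi₀I⟩
  have hKcard : (1 : ℝ) ≤ K.card := by exact_mod_cast hKne.card_pos
  have hIcard : (1 : ℝ) ≤ I.card := by exact_mod_cast hIne.card_pos
  set S := ∑ m, w m * A m with hS
  set Q := ∑ m, w m ^ 2 * B m with hQ
  have hQ0 : 0 < Q := sum_sq_mul_pos_of_sum_eq_one hB0 hsum
  have hwA : ∀ m, 0 ≤ w m * A m := fun m => mul_nonneg (hpos m) (hA0 m).le
  have hwAk₀ : 0 < w k₀ * A k₀ := mul_pos (hwK k₀ hk₀K) (hA0 k₀)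
  have hS0 : 0 < S := sum_pos' (fun m _ => hwA m) ⟨k₀, mem_univ _, hwAk₀⟩
  have hfI : ∀ i ∈ I, 0 < A i * Q - S * (w i * B i) := fun i hi => by
    rw [gradient_coord_eq_sum_ratio_sub hwB i]
    refine mul_pos (mul_pos hc0 (hA0 i)) (sum_pos' (fun m _ => ?_) ⟨k₀, mem_univ _, ?_⟩)
    · exact mul_nonneg (hwA m) (sub_nonneg.2 (hImin i hi m))
    · exact mul_pos hwAk₀ (sub_pos.2 (hlt i hi k₀ hk₀K))
  have hfK : ∀ k ∈ K, A k * Q - S * (w k * B k) ≤ 0 := fun k hk => by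
    rw [gradient_coord_eq_sum_ratio_sub hwB k]
    refine mul_nonpos_of_nonneg_of_nonpos (mul_pos hc0 (hA0 k)).le (sum_nonpos fun m _ => ?_)
    exact mul_nonpos_of_nonneg_of_nonpos (hwA m) (sub_nonpos.2 (hKmax k hk m))
  set d := transferDirection K I with hd
  set a := ∑ j, d j * A j with ha
  set b := ∑ j, d j * (w j * B j) with hb
  set q := ∑ j, d j ^ 2 * B j with hq
  have hq0 : 0 ≤ q := sum_nonneg fun j _ => mul_nonneg (sq_nonneg _) (hB0 j).le
  have hD : 0 < a * Q - S * b := by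
    have hsplit : a * Q - S * b = ∑ j, d j * (A j * Q - S * (w j * B j)) := by
      rw [ha, hb, sum_mul, mul_sum, ← sum_sub_distrib]
      exact sum_congr rfl fun j _ => by ring
    rw [hsplit, hd, sum_transferDirection_mul]
    have h₁ : 0 < 1 / (I.card : ℝ) * ∑ j ∈ I, (A j * Q - S * (w j * B j)) :=
      mul_pos (one_div_pos.2 (by linarith)) (sum_pos hfI hIne)
    have h₂ : 1 / (K.card : ℝ) * ∑ j ∈ K, (A j * Q - S * (w j * B j)) ≤ 0 :=
      mul_nonpos_of_nonneg_of_nonpos (one_div_nonneg.2 (by linarith)) (sum_nonpos hfK)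
    linarith
  have hden : 0 < S ^ 2 * q + 1 := by positivity
  refine ⟨min (K.inf' hKne w) (2 * S * (a * Q - S * b) / (S ^ 2 * q + 1)),
    lt_min ((lt_inf'_iff _).2 hwK) (by positivity), ?_⟩
  intro ε hε hεlt w' hw'
  have hεK : ∀ k ∈ K, ε < w k := (lt_inf'_iff _).1 (hεlt.trans_le (min_le_left _ _))
  have hstep : ε * (S ^ 2 * q) < 2 * S * (a * Q - S * b) := by
    have := (lt_div_iff₀ hden).1 (hεlt.trans_le (min_le_right _ _))
    linarith
  have hw'd : ∀ j, w' j = w j + ε * d j := fun j => by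
    have hdisj : j ∈ K → j ∉ I := fun hk hi => (hlt j hi j hk).false
    by_cases hjK : j ∈ K
    · simp [hw', hd, transferDirection, hjK, hdisj hjK]; ring
    · by_cases hjI : j ∈ I
      · simp [hw', hd, transferDirection, hjK, hjI]; ring
      · simp [hw', hd, transferDirection, hjK, hjI]
  have hsum' : ∑ j, w' j = 1 := by
    simp_rw [hw'd]
    rw [sum_add_distrib, ← mul_sum, sum_transferDirection hKne hIne, hsum, mul_zero, add_zero]
  refine ⟨hsum', fun j => ?_, ?_⟩
  · rw [hw']
    dsimp only
    split_ifs with hjK hjI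
    · linarith [div_le_self hε.le hKcard, hεK j hjK]
    · exact add_nonneg (hpos j) (div_nonneg hε.le (by linarith))
    · exact hpos j
  · have hS' : ∑ j, w' j * A j = S + ε * a := by
      rw [hS, ha, mul_sum, ← sum_add_distrib]
      exact sum_congr rfl fun j _ => by rw [hw'd]; ring
    have hQ' : ∑ j, w' j ^ 2 * B j = Q + 2 * ε * b + ε ^ 2 * q := by
      rw [hQ, hb, hq, mul_sum, mul_sum, ← sum_add_distrib, ← sum_add_distrib]
      exact sum_congr rfl fun j _ => by rw [hw'd]; ring
    rw [hg, hg, hS', hQ']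
    exact sq_div_lt_sq_div_of_step hQ0 hε (hQ' ▸ sum_sq_mul_pos_of_sum_eq_one hB0 hsum') hstep
end

section
/- Let N ≥ 1, ρ ∈ (0,1), and γ : Fin N → ℝ with γ_j > ρ/(1−ρ) for all j. Define A_j = (1−ρ)·γ_j − ρ, B_j = (1−ρ)²·γ_j + (1+ρ²)/2, g(w) = (∑_j w_j·A_j)²/(∑_j w_j²·B_j), and w^o_j = c·A_j/B_j with c = (∑_m A_m/B_m)^{−1}. Then g(w^o) = ∑_{j=1}^{N} A_j²/B_j, and consequently for every feasible weight vector w one has g(w) ≤ ∑_{j=1}^{N} A_j²/B_j. -/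
open Finset

/-- Cauchy–Schwarz bound on a generalized Rayleigh quotient with diagonal denominator. -/
theorem sq_sum_mul_div_sum_sq_mul_le {ι : Type*} (s : Finset ι) (A B w : ι → ℝ)
    (hB : ∀ i ∈ s, 0 < B i) :
    (∑ i ∈ s, w i * A i) ^ 2 / (∑ i ∈ s, w i ^ 2 * B i) ≤ ∑ i ∈ s, A i ^ 2 / B i := by
  have hA' : ∀ i ∈ s, 0 ≤ A i ^ 2 / B i := fun i hi => div_nonneg (sq_nonneg _) (hB i hi).le
  have hw' : ∀ i ∈ s, 0 ≤ w i ^ 2 * B i := fun i hi => mul_nonneg (sq_nonneg _) (hB i hi).le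
  refine div_le_of_le_mul₀ (Finset.sum_nonneg hw') (Finset.sum_nonneg hA') ?_
  refine Finset.sum_sq_le_sum_mul_sum_of_sq_le_mul s hA' hw' fun i hi => le_of_eq ?_
  have := (hB i hi).ne'
  field_simp

/-- The Cauchy–Schwarz bound is attained at weights proportional to `A i / B i`. -/
theorem sq_sum_mul_div_sum_sq_mul_eq {ι : Type*} (s : Finset ι) (A B : ι → ℝ) {c : ℝ}
    (hc : c ≠ 0) (hB : ∀ i ∈ s, B i ≠ 0) :
    (∑ i ∈ s, c * (A i / B i) * A i) ^ 2 / (∑ i ∈ s, (c * (A i / B i)) ^ 2 * B i) =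
      ∑ i ∈ s, A i ^ 2 / B i := by
  have hnum : ∑ i ∈ s, c * (A i / B i) * A i = c * ∑ i ∈ s, A i ^ 2 / B i := by
    rw [Finset.mul_sum]
    exact Finset.sum_congr rfl fun i _ => by ring
  have hden : ∑ i ∈ s, (c * (A i / B i)) ^ 2 * B i = c ^ 2 * ∑ i ∈ s, A i ^ 2 / B i := by
    rw [Finset.mul_sum]
    refine Finset.sum_congr rfl fun i hi => ?_
    have := hB i hi
    field_simp
  rw [hnum, hden, mul_pow, mul_div_mul_left _ _ (pow_ne_zero 2 hc), sq, mul_self_div_self]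

theorem optimal_objective_value
    (N : ℕ) (hN : 1 ≤ N) (ρ : ℝ) (hρ : 0 < ρ) (hρ1 : ρ < 1)
    (γ : Fin N → ℝ) (hγ : ∀ j, ρ / (1 - ρ) < γ j)
    (A B wo : Fin N → ℝ) (c : ℝ) (g : (Fin N → ℝ) → ℝ)
    (hA : ∀ j, A j = (1 - ρ) * γ j - ρ)
    (hB : ∀ j, B j = (1 - ρ) ^ 2 * γ j + (1 + ρ ^ 2) / 2)
    (hg : ∀ v : Fin N → ℝ, g v = (∑ j, v j * A j) ^ 2 / (∑ j, (v j) ^ 2 * B j))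
    (hc : c = (∑ m, A m / B m)⁻¹)
    (hwo : ∀ j, wo j = c * (A j / B j)) :
    g wo = ∑ j, (A j) ^ 2 / B j ∧
      ∀ w : Fin N → ℝ, (∑ j, w j = 1) → (∀ j, 0 ≤ w j) →
        g w ≤ ∑ j, (A j) ^ 2 / B j := by
  have hρ' : 0 < 1 - ρ := sub_pos.mpr hρ1
  have hA_pos : ∀ j, 0 < A j := fun j => by
    have := (div_lt_iff₀ hρ').mp (hγ j)
    rw [hA]
    linarith
  have hB_pos : ∀ j, 0 < B j := fun j => by
    have : 0 < γ j := (div_pos hρ hρ').trans (hγ j)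
    rw [hB]
    positivity
  have : Nonempty (Fin N) := ⟨⟨0, hN⟩⟩
  have hc_ne : c ≠ 0 := hc ▸ inv_ne_zero
    (Finset.sum_pos (fun j _ => div_pos (hA_pos j) (hB_pos j)) Finset.univ_nonempty).ne'
  refine ⟨?_, fun w _ _ => ?_⟩
  · simp only [hg, hwo]
    exact sq_sum_mul_div_sum_sq_mul_eq _ A B hc_ne fun j _ => (hB_pos j).ne'
  · rw [hg]
    exact sq_sum_mul_div_sum_sq_mul_le _ A B w fun j _ => hB_pos j
end
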